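/- Let p_1, …, p_n ∈ (0,1), let B_1, …, B_n be independent with P(B_k = 1) = p_k and P(B_k = 0) = 1 − p_k, set X_k := (B_k − p_k)/√(p_k(1 − p_k)), and let α_1, …, α_n ∈ ℝ. Then d_W( Σ_{k=1}^n α_k X_k, 𝒩 ) ≤ |1 − Σ_{k=1}^n α_k²| + 2 Σ_{k=1}^n |α_k|³ (1 − 2 p_k(1 − p_k)) / √(p_k(1 − p_k)). -/

import Mathlib

open MeasureTheory ProbabilityTheory

/-- Wasserstein distance between two laws on `ℝ`, as a supremum over
1-Lipschitz test functions. -/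
noncomputable def dW (μ ν : Measure ℝ) : ℝ :=
  ⨆ h : {f : ℝ → ℝ // LipschitzWith 1 f}, |(∫ x, h.1 x ∂μ) - ∫ x, h.1 x ∂ν|

/-- The standard Gaussian law `N(0,1)` on `ℝ`. -/
noncomputable def stdGaussian : Measure ℝ := gaussianReal 0 1

open scoped NNReal
open Filter Topology

theorem two_mul_mul_le_of_mills {x a ψ φ : ℝ} (hx : 0 ≤ x) (ha : 0 ≤ a) (hψ : 0 ≤ ψ)
    (hφ : φ = ψ + x * a) (hcs : ψ * φ ≤ a ^ 2) (hhalf : φ ≤ 1 / 2) (hpos : 0 < φ) :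
    2 * (ψ * (ψ + x)) ≤ φ := by
  have hψa : ψ ≤ a := by
    have : ψ ^ 2 ≤ a ^ 2 := by nlinarith [mul_nonneg hψ (mul_nonneg hx ha)]
    exact abs_le_of_sq_le_sq' this ha |>.2
  have key : 2 * ψ * (φ - a) ≤ x * a ^ 2 := by
    rcases le_or_gt (2 * ψ) a with h | h
    · have h1 : 2 * ψ * (φ - a) = 2 * ψ * (ψ - a) + x * a * (2 * ψ) := by rw [hφ]; ring
      nlinarith [mul_nonneg hψ (sub_nonneg.2 hψa),
        mul_nonneg (mul_nonneg hx ha) (sub_nonneg.2 h)]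
    · have hψ0 : 0 < ψ := by linarith
      have h2 : x * a * ψ ≤ (a - ψ) * (a + ψ) := by rw [hφ] at hcs; linarith
      have h3 : x * a * ψ * (2 * ψ - a) ≤ (a - ψ) * (a + ψ) * (2 * ψ - a) :=
        mul_le_mul_of_nonneg_right h2 (by linarith)
      have h4 : (a - ψ) * (a + ψ) * (2 * ψ - a) ≤ (a - ψ) * (2 * ψ) * ψ := by
        have : 0 ≤ (a - ψ) * (a - ψ) * a := by positivity
        nlinarith
      have h5 : (x * a * (2 * ψ - a)) * ψ ≤ ((a - ψ) * (2 * ψ)) * ψ := by linarith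
      have h6 := le_of_mul_le_mul_right h5 hψ0
      rw [hφ]; linarith
  have h1 : ψ ^ 2 * (2 * φ) ≤ ψ ^ 2 * 1 := by gcongr; linarith
  have h2 : x * (2 * ψ * (φ - a)) ≤ x * (x * a ^ 2) := by gcongr
  have h3 : (2 * (ψ * (ψ + x))) * φ ≤ φ * φ := by
    have : φ * φ = ψ ^ 2 + 2 * x * a * ψ + x ^ 2 * a ^ 2 := by rw [hφ]; ring
    nlinarith
  exact le_of_mul_le_mul_right h3 hpos

local notation "φ" => gaussianPDFReal 0 1

theorem gaussianPDFReal_std_apply (x : ℝ) :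
    φ x = (√(2 * Real.pi))⁻¹ * Real.exp (-x ^ 2 / 2) := by
  simp [gaussianPDFReal]

theorem gaussianPDFReal_std_pos (x : ℝ) : 0 < φ x := gaussianPDFReal_pos 0 1 x one_ne_zero

theorem gaussianPDFReal_std_le_half (x : ℝ) : φ x ≤ 1 / 2 := by
  rw [gaussianPDFReal_std_apply]
  have h1 : (2 : ℝ) ≤ √(2 * Real.pi) := by
    apply Real.le_sqrt_of_sq_le
    linarith [Real.pi_gt_three]
  have h2 : (√(2 * Real.pi))⁻¹ ≤ 2⁻¹ := by gcongr
  have h3 : Real.exp (-x ^ 2 / 2) ≤ 1 := Real.exp_le_one_iff.2 (by nlinarith [sq_nonneg x])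
  calc _ ≤ (2 : ℝ)⁻¹ * 1 := by gcongr
    _ = 1 / 2 := by norm_num

theorem hasDerivAt_gaussianPDFReal_std (x : ℝ) : HasDerivAt φ (-(x * φ x)) x := by
  have hfun : φ = fun x => (√(2 * Real.pi))⁻¹ * Real.exp (-x ^ 2 / 2) :=
    funext gaussianPDFReal_std_apply
  have h : HasDerivAt (fun x : ℝ => -x ^ 2 / 2) (-x) x :=
    ((hasDerivAt_pow 2 x).neg.div_const 2).congr_deriv (by simp; ring)
  rw [hfun]
  exact (h.exp.const_mul (√(2 * Real.pi))⁻¹).congr_deriv (by ring)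

theorem integrable_mul_gaussianPDFReal {g : ℝ → ℝ} (hg : Integrable g (gaussianReal 0 1)) :
    Integrable (fun t => g t * φ t) := by
  rw [gaussianReal_of_var_ne_zero 0 one_ne_zero,
    integrable_withDensity_iff_integrable_smul' (measurable_gaussianPDF 0 1)
      (ae_of_all _ fun _ => gaussianPDF_lt_top)] at hg
  simpa [gaussianPDF, ENNReal.toReal_ofReal, gaussianPDFReal_nonneg, mul_comm] using hg

theorem integrable_pow_mul_gaussianPDFReal (k : ℕ) : Integrable (fun t => t ^ k * φ t) := by
  refine integrable_mul_gaussianPDFReal ?_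
  have h := (memLp_id_gaussianReal (μ := 0) (v := 1) (k : ℝ≥0)).integrable_norm_pow'
  rw [← integrable_norm_iff (by fun_prop)]
  simpa using h

theorem LipschitzWith.integrable_comp_of_integrable {Ω : Type*} [MeasurableSpace Ω]
    {μ : Measure Ω} [IsFiniteMeasure μ] {g : ℝ → ℝ} {K : ℝ≥0}
    (hg : LipschitzWith K g) {Y : Ω → ℝ} (hY : Integrable Y μ) :
    Integrable (fun ω => g (Y ω)) μ := by
  refine ((integrable_const |g 0|).add (hY.norm.const_mul (K : ℝ))).mono'
    (hg.continuous.comp_aestronglyMeasurable hY.1) (ae_of_all _ fun ω => ?_)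
  have h1 := hg.dist_le_mul (Y ω) 0
  simp only [Real.dist_eq, sub_zero] at h1
  have h2 := abs_add_le (g (Y ω) - g 0) (g 0)
  simp only [sub_add_cancel] at h2
  simp only [Pi.add_apply, Real.norm_eq_abs]
  linarith

theorem LipschitzWith.integrable_gaussianReal {h : ℝ → ℝ} {K : ℝ≥0} (hh : LipschitzWith K h) :
    Integrable h (gaussianReal 0 1) :=
  hh.integrable_comp_of_integrable
    ((memLp_id_gaussianReal (μ := 0) (v := 1) 1).integrable (by norm_num))

theorem integral_Ioi_id_mul_gaussianPDFReal (x : ℝ) : ∫ t in Set.Ioi x, t * φ t = φ x := by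
  have hi : Integrable (fun t => -(t * φ t)) := by
    simpa using (integrable_pow_mul_gaussianPDFReal 1).neg
  have h0 := tendsto_zero_of_hasDerivAt_of_integrableOn_Ioi (a := x)
    (fun t _ => hasDerivAt_gaussianPDFReal_std t) hi.integrableOn
    (integrable_gaussianPDFReal 0 1).integrableOn
  have h := integral_Ioi_of_hasDerivAt_of_tendsto' (a := x)
    (fun t _ => hasDerivAt_gaussianPDFReal_std t) hi.integrableOn h0
  rw [integral_neg] at h
  linarith

theorem integral_Iic_id_mul_gaussianPDFReal (x : ℝ) : ∫ t in Set.Iic x, t * φ t = -φ x := by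
  have hi : Integrable (fun t => -(t * φ t)) := by
    simpa using (integrable_pow_mul_gaussianPDFReal 1).neg
  have h0 := tendsto_zero_of_hasDerivAt_of_integrableOn_Iic (a := x)
    (fun t _ => hasDerivAt_gaussianPDFReal_std t) hi.integrableOn
    (integrable_gaussianPDFReal 0 1).integrableOn
  have h := integral_Iic_of_hasDerivAt_of_tendsto' (a := x)
    (fun t _ => hasDerivAt_gaussianPDFReal_std t) hi.integrableOn h0
  rw [integral_neg] at h
  linarith

theorem hasDerivAt_id_mul_gaussianPDFReal (x : ℝ) :
    HasDerivAt (fun t => t * φ t) (φ x - x ^ 2 * φ x) x :=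
  ((hasDerivAt_id' x).mul (hasDerivAt_gaussianPDFReal_std x)).congr_deriv (by ring)

theorem integral_Ioi_sq_mul_gaussianPDFReal (x : ℝ) :
    ∫ t in Set.Ioi x, t ^ 2 * φ t = x * φ x + ∫ t in Set.Ioi x, φ t := by
  have hφ := integrable_gaussianPDFReal 0 1
  have h2 := integrable_pow_mul_gaussianPDFReal 2
  have h1 : Integrable (fun t => t * φ t) := by simpa using integrable_pow_mul_gaussianPDFReal 1
  have h0 := tendsto_zero_of_hasDerivAt_of_integrableOn_Ioi (a := x)
    (fun t _ => hasDerivAt_id_mul_gaussianPDFReal t) (hφ.sub h2).integrableOn h1.integrableOn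
  have h := integral_Ioi_of_hasDerivAt_of_tendsto' (a := x)
    (fun t _ => hasDerivAt_id_mul_gaussianPDFReal t) (hφ.sub h2).integrableOn h0
  rw [integral_sub hφ.integrableOn h2.integrableOn] at h
  linarith

theorem integral_Iic_sq_mul_gaussianPDFReal (x : ℝ) :
    ∫ t in Set.Iic x, t ^ 2 * φ t = -(x * φ x) + ∫ t in Set.Iic x, φ t := by
  have hφ := integrable_gaussianPDFReal 0 1
  have h2 := integrable_pow_mul_gaussianPDFReal 2
  have h1 : Integrable (fun t => t * φ t) := by simpa using integrable_pow_mul_gaussianPDFReal 1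
  have h0 := tendsto_zero_of_hasDerivAt_of_integrableOn_Iic (a := x)
    (fun t _ => hasDerivAt_id_mul_gaussianPDFReal t) (hφ.sub h2).integrableOn h1.integrableOn
  have h := integral_Iic_of_hasDerivAt_of_tendsto' (a := x)
    (fun t _ => hasDerivAt_id_mul_gaussianPDFReal t) (hφ.sub h2).integrableOn h0
  rw [integral_sub hφ.integrableOn h2.integrableOn] at h
  linarith

theorem gaussian_truncated_quadratic_nonneg (S : Set ℝ) (x y : ℝ) :
    0 ≤ (∫ t in S, φ t) * (y * y) +
      (-2 * ((∫ t in S, t * φ t) - x * ∫ t in S, φ t)) * y +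
      ((∫ t in S, t ^ 2 * φ t) - 2 * x * (∫ t in S, t * φ t) + x ^ 2 * ∫ t in S, φ t) := by
  have h0 := (integrable_gaussianPDFReal 0 1).integrableOn (s := S)
  have h1 : IntegrableOn (fun t => t * φ t) S := by
    simpa using (integrable_pow_mul_gaussianPDFReal 1).integrableOn (s := S)
  have h2 := (integrable_pow_mul_gaussianPDFReal 2).integrableOn (s := S)
  have hnn : 0 ≤ ∫ t in S, (t - x - y) ^ 2 * φ t :=
    integral_nonneg fun t => mul_nonneg (sq_nonneg _) (gaussianPDFReal_nonneg 0 1 t)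
  have hexp : (fun t => (t - x - y) ^ 2 * φ t) =
      fun t => t ^ 2 * φ t - 2 * (x + y) * (t * φ t) + (x + y) ^ 2 * φ t := by
    funext t; ring
  have h12 : IntegrableOn (fun t => t ^ 2 * φ t - 2 * (x + y) * (t * φ t)) S :=
    h2.sub (h1.const_mul _)
  rw [hexp, integral_add h12 (h0.const_mul _), integral_sub h2 (h1.const_mul _),
    integral_const_mul, integral_const_mul] at hnn
  linarith

theorem sq_gaussian_first_moment_le (S : Set ℝ) (x : ℝ) :
    ((∫ t in S, t * φ t) - x * ∫ t in S, φ t) ^ 2 ≤ (∫ t in S, φ t) *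
      ((∫ t in S, t ^ 2 * φ t) - 2 * x * (∫ t in S, t * φ t) + x ^ 2 * ∫ t in S, φ t) := by
  have := discrim_le_zero (gaussian_truncated_quadratic_nonneg S x)
  rw [discrim] at this
  linarith

theorem abs_integral_lipschitz_mul_le {h : ℝ → ℝ} (hh : LipschitzWith 1 h) {S : Set ℝ}
    (hS : MeasurableSet S) {x ε : ℝ} (hε : ∀ t ∈ S, |t - x| = ε * (t - x)) :
    |∫ t in S, (h t - h x) * φ t| ≤ ε * ((∫ t in S, t * φ t) - x * ∫ t in S, φ t) := by
  have h0 := (integrable_gaussianPDFReal 0 1).integrableOn (s := S)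
  have h1 : IntegrableOn (fun t => t * φ t) S := by
    simpa using (integrable_pow_mul_gaussianPDFReal 1).integrableOn (s := S)
  have hint : IntegrableOn (fun t => ε * (t * φ t - x * φ t)) S :=
    (h1.sub (h0.const_mul x)).const_mul ε
  calc |∫ t in S, (h t - h x) * φ t| ≤ ∫ t in S, ε * (t * φ t - x * φ t) := by
        rw [← Real.norm_eq_abs]
        refine norm_integral_le_of_norm_le hint ((ae_restrict_iff' hS).2 (ae_of_all _ ?_))
        intro t ht
        have h3 := hh.dist_le_mul t x
        simp only [Real.dist_eq, NNReal.coe_one, one_mul] at h3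
        rw [Real.norm_eq_abs, abs_mul, abs_of_nonneg (gaussianPDFReal_nonneg 0 1 t)]
        calc |h t - h x| * φ t ≤ |t - x| * φ t :=
              mul_le_mul_of_nonneg_right h3 (gaussianPDFReal_nonneg 0 1 t)
          _ = _ := by rw [hε t ht]; ring
    _ = _ := by
        rw [integral_const_mul, integral_sub h1 (h0.const_mul x), integral_const_mul]

theorem integral_gaussianPDFReal_Iic_add_Ioi (x : ℝ) :
    (∫ t in Set.Iic x, φ t) + ∫ t in Set.Ioi x, φ t = 1 := by
  rw [intervalIntegral.integral_Iic_add_Ioi (integrable_gaussianPDFReal 0 1).integrableOn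
    (integrable_gaussianPDFReal 0 1).integrableOn]
  exact integral_gaussianPDFReal_eq_one 0 one_ne_zero

/-- The solution of Stein's equation `f' x - x * f x = h x - E[h(Z)]` with `Z` standard
Gaussian. -/
noncomputable def steinSolution (h : ℝ → ℝ) (x : ℝ) : ℝ :=
  (∫ t in Set.Iic x, (h t - ∫ s, h s ∂gaussianReal 0 1) * φ t) / φ x

theorem hasDerivAt_integral_Iic {g : ℝ → ℝ} (hg : Integrable g) (hc : Continuous g) (x : ℝ) :
    HasDerivAt (fun y => ∫ t in Set.Iic y, g t) (g x) x := by
  have h1 : HasDerivAt (fun y => (∫ t in Set.Iic 0, g t) + ∫ t in (0 : ℝ)..y, g t) (g x) x :=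
    (intervalIntegral.integral_hasDerivAt_right (hc.intervalIntegrable 0 x)
      (hc.stronglyMeasurableAtFilter _ _) hc.continuousAt).const_add _
  refine h1.congr_of_eventuallyEq (Eventually.of_forall fun y => ?_)
  simp only
  rw [← intervalIntegral.integral_Iic_sub_Iic hg.integrableOn hg.integrableOn]
  ring

theorem hasDerivAt_steinSolution {h : ℝ → ℝ} {K : ℝ≥0} (hh : LipschitzWith K h) (x : ℝ) :
    HasDerivAt (steinSolution h)
      (h x - (∫ s, h s ∂gaussianReal 0 1) + x * steinSolution h x) x := by
  have hφc : Continuous φ :=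
    continuous_iff_continuousAt.2 fun x => (hasDerivAt_gaussianPDFReal_std x).continuousAt
  have h1 := hasDerivAt_integral_Iic
    (integrable_mul_gaussianPDFReal
      (hh.integrable_gaussianReal.sub (integrable_const (∫ s, h s ∂gaussianReal 0 1))))
    ((hh.continuous.sub continuous_const).mul hφc) x
  have hpos := (gaussianPDFReal_std_pos x).ne'
  refine (h1.div (hasDerivAt_gaussianPDFReal_std x) hpos).congr_deriv ?_
  simp only [steinSolution, Pi.sub_apply]
  field_simp
  ring

theorem steinSolution_bounds {h : ℝ → ℝ} (hh : LipschitzWith 1 h) (x : ℝ) :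
    |h x - (∫ s, h s ∂gaussianReal 0 1) + x * steinSolution h x| ≤ 1 ∧
    |steinSolution h x +
      x * (h x - (∫ s, h s ∂gaussianReal 0 1) + x * steinSolution h x)| ≤ 1 := by
  set m := ∫ s, h s ∂gaussianReal 0 1 with hm
  set a := ∫ t in Set.Ioi x, φ t with ha
  set b := ∫ t in Set.Iic x, φ t with hb
  set I₁ := ∫ t in Set.Iic x, (h t - h x) * φ t with hI₁
  set I₂ := ∫ t in Set.Ioi x, (h t - h x) * φ t with hI₂
  have hab : b + a = 1 := integral_gaussianPDFReal_Iic_add_Ioi x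
  have ha0 : 0 ≤ a := integral_nonneg fun t => gaussianPDFReal_nonneg 0 1 t
  have hb0 : 0 ≤ b := integral_nonneg fun t => gaussianPDFReal_nonneg 0 1 t
  have hpos := gaussianPDFReal_std_pos x
  have hhalf := gaussianPDFReal_std_le_half x
  have hφi := integrable_gaussianPDFReal 0 1
  have hgi : Integrable (fun t => (h t - h x) * φ t) :=
    integrable_mul_gaussianPDFReal (hh.integrable_gaussianReal.sub (integrable_const (h x)))
  have hk : h x - m = -(I₁ + I₂) := by
    have h1 : I₁ + I₂ = ∫ t, (h t - h x) * φ t :=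
      intervalIntegral.integral_Iic_add_Ioi hgi.integrableOn hgi.integrableOn
    have h2 : ∫ t, (h t - h x) * φ t = ∫ t, (h t - h x) ∂gaussianReal 0 1 := by
      rw [integral_gaussianReal_eq_integral_smul one_ne_zero]
      simp [mul_comm]
    rw [integral_sub hh.integrable_gaussianReal (integrable_const _)] at h2
    simp at h2
    linarith
  have hF : steinSolution h x * φ x = a * I₁ - b * I₂ := by
    rw [steinSolution, div_mul_cancel₀ _ hpos.ne', ← hm]
    have h1 : (fun t => (h t - m) * φ t) = fun t => (h t - h x) * φ t + (h x - m) * φ t := by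
      funext t; ring
    rw [h1, integral_add hgi.integrableOn (hφi.integrableOn.const_mul _), integral_const_mul,
      ← hI₁, ← hb, hk]
    linear_combination (-I₁) * hab
  have hI₁le : |I₁| ≤ φ x + x * b := by
    have := abs_integral_lipschitz_mul_le hh measurableSet_Iic (x := x) (ε := -1)
      (S := Set.Iic x) fun t ht => by
        rw [abs_of_nonpos (sub_nonpos.2 ht)]; ring
    rw [integral_Iic_id_mul_gaussianPDFReal] at this
    linarith
  have hI₂le : |I₂| ≤ φ x - x * a := by
    have := abs_integral_lipschitz_mul_le hh measurableSet_Ioi (x := x) (ε := 1)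
      (S := Set.Ioi x) fun t ht => by
        rw [abs_of_pos (sub_pos.2 ht)]; ring
    rw [integral_Ioi_id_mul_gaussianPDFReal] at this
    linarith
  have hQ : 0 ≤ φ x + x * b := (abs_nonneg _).trans hI₁le
  have hP : 0 ≤ φ x - x * a := (abs_nonneg _).trans hI₂le
  have hcsa := sq_gaussian_first_moment_le (Set.Ioi x) x
  rw [integral_Ioi_id_mul_gaussianPDFReal, integral_Ioi_sq_mul_gaussianPDFReal, ← ha] at hcsa
  have hcsb := sq_gaussian_first_moment_le (Set.Iic x) x
  rw [integral_Iic_id_mul_gaussianPDFReal, integral_Iic_sq_mul_gaussianPDFReal, ← hb] at hcsb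
  have hPQ : 2 * ((φ x - x * a) * (φ x + x * b)) ≤ φ x := by
    rcases le_total 0 x with hx | hx
    · have := two_mul_mul_le_of_mills hx ha0 hP (by ring) (by linarith) hhalf hpos
      have h2 : φ x - x * a + x = φ x + x * b := by linear_combination (-x) * hab
      rwa [h2] at this
    · have := two_mul_mul_le_of_mills (neg_nonneg.2 hx) hb0 hQ (by ring) (by linarith)
        hhalf hpos
      have h2 : φ x + x * b + -x = φ x - x * a := by linear_combination x * hab
      rw [h2] at this
      linarith
  have hA : 0 ≤ (1 + x ^ 2) * a - x * φ x := by
    have := gaussian_truncated_quadratic_nonneg (Set.Ioi x) x 0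
    rw [integral_Ioi_id_mul_gaussianPDFReal, integral_Ioi_sq_mul_gaussianPDFReal, ← ha] at this
    linarith
  have hB : 0 ≤ (1 + x ^ 2) * b + x * φ x := by
    have := gaussian_truncated_quadratic_nonneg (Set.Iic x) x 0
    rw [integral_Iic_id_mul_gaussianPDFReal, integral_Iic_sq_mul_gaussianPDFReal, ← hb] at this
    linarith
  constructor
  · rw [hk, ← mul_le_mul_iff_left₀ hpos, ← abs_of_pos hpos, ← abs_mul, abs_of_pos hpos]
    have h1 : (-(I₁ + I₂) + x * steinSolution h x) * φ x =
        -((φ x - x * a) * I₁ + (φ x + x * b) * I₂) := by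
      linear_combination x * hF
    rw [h1, abs_neg]
    calc _ ≤ |(φ x - x * a) * I₁| + |(φ x + x * b) * I₂| := abs_add_le _ _
      _ = (φ x - x * a) * |I₁| + (φ x + x * b) * |I₂| := by
        rw [abs_mul, abs_mul, abs_of_nonneg hP, abs_of_nonneg hQ]
      _ ≤ (φ x - x * a) * (φ x + x * b) + (φ x + x * b) * (φ x - x * a) := by gcongr
      _ ≤ 1 * φ x := by linarith
  · rw [hk, ← mul_le_mul_iff_left₀ hpos, ← abs_of_pos hpos, ← abs_mul, abs_of_pos hpos]
    have h1 : (steinSolution h x + x * (-(I₁ + I₂) + x * steinSolution h x)) * φ x =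
        ((1 + x ^ 2) * a - x * φ x) * I₁ - ((1 + x ^ 2) * b + x * φ x) * I₂ := by
      linear_combination (1 + x ^ 2) * hF
    rw [h1]
    calc _ ≤ |((1 + x ^ 2) * a - x * φ x) * I₁| + |((1 + x ^ 2) * b + x * φ x) * I₂| :=
          abs_sub _ _
      _ = ((1 + x ^ 2) * a - x * φ x) * |I₁| + ((1 + x ^ 2) * b + x * φ x) * |I₂| := by
        rw [abs_mul, abs_mul, abs_of_nonneg hA, abs_of_nonneg hB]
      _ ≤ ((1 + x ^ 2) * a - x * φ x) * (φ x + x * b) +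
          ((1 + x ^ 2) * b + x * φ x) * (φ x - x * a) := by gcongr
      _ = 1 * φ x := by linear_combination φ x * hab

theorem exists_steinSolution {h : ℝ → ℝ} (hh : LipschitzWith 1 h) :
    ∃ f f' : ℝ → ℝ, (∀ x, HasDerivAt f (f' x) x) ∧
      (∀ x, f' x - x * f x = h x - ∫ s, h s ∂gaussianReal 0 1) ∧
      LipschitzWith 2 f' ∧ (∀ x, |f' x| ≤ 1) := by
  set m := ∫ s, h s ∂gaussianReal 0 1 with hm
  refine ⟨steinSolution h, fun x => h x - m + x * steinSolution h x,
    hasDerivAt_steinSolution hh, fun x => by ring, ?_, fun x => (steinSolution_bounds hh x).1⟩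
  have hd : ∀ x, HasDerivAt (fun x => x * steinSolution h x)
      (steinSolution h x + x * (h x - m + x * steinSolution h x)) x := fun x =>
    ((hasDerivAt_id' x).mul (hasDerivAt_steinSolution hh x)).congr_deriv (by ring)
  have h1 : LipschitzWith 1 fun x => x * steinSolution h x :=
    lipschitzWith_of_nnnorm_deriv_le (fun x => (hd x).differentiableAt) fun x => by
      rw [(hd x).deriv, ← NNReal.coe_le_coe, coe_nnnorm]
      exact (steinSolution_bounds hh x).2
  have h2 : LipschitzWith 1 fun x => h x - m := by
    simpa using hh.sub (LipschitzWith.const m)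
  have h3 := h2.add h1
  rwa [one_add_one_eq_two] at h3

theorem abs_taylor_le_of_lipschitz_deriv {f f' : ℝ → ℝ} (hf : ∀ x, HasDerivAt f (f' x) x)
    (hf' : LipschitzWith 2 f') (v d : ℝ) : |f (v + d) - f v - d * f' v| ≤ d ^ 2 := by
  have hder : ∀ t, HasDerivAt (fun t => f (v + t * d)) (f' (v + t * d) * d) t := fun t =>
    (hf (v + t * d)).comp t
      ((((hasDerivAt_id' t).mul_const d).const_add v).congr_deriv (by ring))
  have hcont : Continuous fun t => f' (v + t * d) * d := by
    have := hf'.continuous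
    fun_prop
  have h1 := intervalIntegral.integral_eq_sub_of_hasDerivAt (a := 0) (b := 1)
    (fun t _ => hder t) (hcont.intervalIntegrable 0 1)
  have h2 : f (v + d) - f v - d * f' v =
      ∫ t in (0 : ℝ)..1, (f' (v + t * d) * d - f' v * d) := by
    rw [intervalIntegral.integral_sub (hcont.intervalIntegrable 0 1) (by simp), h1]
    simp
    ring
  have h3 : ∫ t in (0 : ℝ)..1, 2 * d ^ 2 * t = d ^ 2 := by
    rw [intervalIntegral.integral_const_mul, integral_id]
    ring
  rw [h2, ← h3, ← Real.norm_eq_abs]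
  refine intervalIntegral.norm_integral_le_of_norm_le zero_le_one
    (ae_of_all _ fun t ht => ?_) (by apply Continuous.intervalIntegrable; fun_prop)
  have h4 := hf'.dist_le_mul (v + t * d) v
  rw [Real.dist_eq, Real.dist_eq, NNReal.coe_ofNat, add_sub_cancel_left, abs_mul,
    abs_of_pos ht.1] at h4
  rw [Real.norm_eq_abs, ← sub_mul, abs_mul, ← sq_abs d]
  nlinarith [abs_nonneg d]

/-- Comparison, for `X` a standardised Bernoulli variable, of `α * E[X * f (y + α * X)]` with
`α ^ 2 * E[f' (y + α * X)]`, both expectations being written out as two-point averages. -/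
theorem abs_two_point_stein_le {f f' : ℝ → ℝ} (hf : ∀ x, HasDerivAt f (f' x) x)
    (hf' : LipschitzWith 2 f') {p : ℝ} (hp : p ∈ Set.Ioo (0 : ℝ) 1) (α y : ℝ) :
    |α ^ 2 * (p * f' (y + α * ((1 - p) / √(p * (1 - p)))) +
        (1 - p) * f' (y + α * ((0 - p) / √(p * (1 - p))))) -
      α * √(p * (1 - p)) * (f (y + α * ((1 - p) / √(p * (1 - p)))) -
        f (y + α * ((0 - p) / √(p * (1 - p)))))| ≤
    2 * (|α| ^ 3 * (1 - 2 * p * (1 - p)) / √(p * (1 - p))) := by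
  obtain ⟨hp0, hp1⟩ := hp
  have hpq : 0 < p * (1 - p) := mul_pos hp0 (by linarith)
  set s := √(p * (1 - p)) with hs
  have hs0 : 0 < s := Real.sqrt_pos.2 hpq
  set u := y + α * ((0 - p) / s) with hu
  set d := α / s with hd
  have hud : y + α * ((1 - p) / s) = u + d := by rw [hu, hd]; field_simp; ring
  have hαd : α ^ 2 = α * s * d := by rw [hd]; field_simp
  rw [hud, hαd]
  have h1 := abs_taylor_le_of_lipschitz_deriv hf hf' u d
  have h2 := abs_taylor_le_of_lipschitz_deriv hf hf' (u + d) (-d)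
  rw [add_neg_cancel_right, neg_sq] at h2
  have h3 : α * s * d * (p * f' (u + d) + (1 - p) * f' u) - α * s * (f (u + d) - f u) =
      α * s * (p * (f u - f (u + d) - -d * f' (u + d)) -
        (1 - p) * (f (u + d) - f u - d * f' u)) := by ring
  rw [h3, abs_mul, abs_mul, abs_of_pos hs0]
  have h4 : |p * (f u - f (u + d) - -d * f' (u + d)) - (1 - p) * (f (u + d) - f u - d * f' u)| ≤
      d ^ 2 := by
    refine (abs_sub _ _).trans ?_
    rw [abs_mul, abs_mul, abs_of_pos hp0, abs_of_pos (sub_pos.2 hp1)]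
    calc _ ≤ p * d ^ 2 + (1 - p) * d ^ 2 := by
          have := sub_pos.2 hp1
          gcongr
      _ = d ^ 2 := by ring
  calc |α| * s * _ ≤ |α| * s * d ^ 2 := by gcongr
    _ = |α| ^ 3 / s * 1 := by rw [hd, div_pow, ← sq_abs α]; field_simp
    _ ≤ |α| ^ 3 / s * (2 * (1 - 2 * p * (1 - p))) := by
        gcongr
        nlinarith [sq_nonneg (2 * p - 1)]
    _ = _ := by ring

section Bernoulli

variable {Ω : Type*} [MeasurableSpace Ω] {μ : Measure Ω}

theorem ae_eq_one_or_eq_zero [IsProbabilityMeasure μ] {B : Ω → ℝ} (hB : Measurable B) {p : ℝ}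
    (hp : p ∈ Set.Ioo (0 : ℝ) 1) (hone : μ {ω | B ω = 1} = ENNReal.ofReal p)
    (hzero : μ {ω | B ω = 0} = ENNReal.ofReal (1 - p)) :
    ∀ᵐ ω ∂μ, B ω = 1 ∨ B ω = 0 := by
  have h1 : MeasurableSet {ω | B ω = 1} := hB (measurableSet_singleton 1)
  have h0 : MeasurableSet {ω | B ω = 0} := hB (measurableSet_singleton 0)
  have hd : Disjoint {ω | B ω = 1} {ω | B ω = 0} :=
    Set.disjoint_left.2 fun ω (ha : B ω = 1) (hb : B ω = 0) => by linarith
  have h := measure_union (μ := μ) hd h0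
  rw [hone, hzero, ← ENNReal.ofReal_add hp.1.le (sub_pos.2 hp.2).le, add_sub_cancel,
    ENNReal.ofReal_one] at h
  exact (mem_ae_iff_prob_eq_one (h1.union h0)).2 h

theorem integrable_of_ae_zero_one [IsProbabilityMeasure μ] {B : Ω → ℝ} (hB : Measurable B)
    (h : ∀ᵐ ω ∂μ, B ω = 1 ∨ B ω = 0) : Integrable B μ := by
  refine Integrable.of_bound hB.aestronglyMeasurable 1 (h.mono fun ω hω => ?_)
  rcases hω with hω | hω <;> simp [hω]

theorem integral_eq_of_ae_zero_one {B : Ω → ℝ} (hB : Measurable B) {p : ℝ} (hp : 0 ≤ p)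
    (hone : μ {ω | B ω = 1} = ENNReal.ofReal p) (h : ∀ᵐ ω ∂μ, B ω = 1 ∨ B ω = 0) :
    ∫ ω, B ω ∂μ = p := by
  have h1 : MeasurableSet {ω | B ω = 1} := hB (measurableSet_singleton 1)
  have h2 : B =ᵐ[μ] Set.indicator {ω | B ω = 1} 1 := by
    filter_upwards [h] with ω hω
    rcases hω with hω | hω <;> simp [Set.indicator, hω]
  rw [integral_congr_ae h2, integral_indicator_one h1, measureReal_def, hone,
    ENNReal.toReal_ofReal hp]

/-- Conditioning on an independent Bernoulli variable. -/
theorem integral_bernoulli_mul [IsProbabilityMeasure μ] {B Y : Ω → ℝ}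
    (hB : Measurable B) (hY : Integrable Y μ)
    {p : ℝ} (hp : 0 ≤ p) (hone : μ {ω | B ω = 1} = ENNReal.ofReal p)
    (h01 : ∀ᵐ ω ∂μ, B ω = 1 ∨ B ω = 0) (hBY : IndepFun B Y μ)
    {g : ℝ → ℝ} {K : ℝ≥0} (hg : LipschitzWith K g) (c : ℝ → ℝ) (w : ℝ → ℝ) :
    Integrable (fun ω => c (B ω) * g (Y ω + w (B ω))) μ ∧
    ∫ ω, c (B ω) * g (Y ω + w (B ω)) ∂μ =
      ∫ ω, (p * (c 1 * g (Y ω + w 1)) + (1 - p) * (c 0 * g (Y ω + w 0))) ∂μ := by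
  have hG : ∀ z, Integrable (fun ω => g (Y ω + z)) μ := fun z =>
    hg.integrable_comp_of_integrable (hY.add (integrable_const z))
  have hind : ∀ z, IndepFun B (fun ω => g (Y ω + z)) μ := fun z =>
    hBY.comp measurable_id
      (hg.continuous.measurable.comp (measurable_id.add_const z))
  have hBi := integrable_of_ae_zero_one hB h01
  have hBG : ∀ z, Integrable (fun ω => B ω * g (Y ω + z)) μ := fun z =>
    (hind z).integrable_mul hBi (hG z)
  have hval : ∀ z, ∫ ω, B ω * g (Y ω + z) ∂μ = p * ∫ ω, g (Y ω + z) ∂μ := fun z => by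
    rw [(hind z).integral_fun_mul_eq_mul_integral hBi.1 (hG z).1,
      integral_eq_of_ae_zero_one hB hp hone h01]
  have hae : (fun ω => c 1 * (B ω * g (Y ω + w 1)) +
      c 0 * (g (Y ω + w 0) - B ω * g (Y ω + w 0))) =ᵐ[μ]
      fun ω => c (B ω) * g (Y ω + w (B ω)) := by
    filter_upwards [h01] with ω hω
    rcases hω with hω | hω <;> simp [hω]
  have hi1 := (hBG (w 1)).const_mul (c 1)
  have hi0 := ((hG (w 0)).sub (hBG (w 0))).const_mul (c 0)
  refine ⟨(hi1.add hi0).congr hae, ?_⟩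
  rw [← integral_congr_ae hae, integral_add (((hG _).const_mul _).const_mul _)
    (((hG _).const_mul _).const_mul _), integral_const_mul, integral_const_mul,
    integral_const_mul, integral_const_mul]
  refine (integral_add hi1 hi0).trans ?_
  have := integral_sub (hG (w 0)) (hBG (w 0))
  simp only [Pi.sub_apply]
  rw [integral_const_mul, integral_const_mul, this, hval, hval]
  ring

theorem abs_bernoulli_stein_le [IsProbabilityMeasure μ] {B Y : Ω → ℝ}
    (hB : Measurable B) (hY : Integrable Y μ)
    {p : ℝ} (hp : p ∈ Set.Ioo (0 : ℝ) 1) (hone : μ {ω | B ω = 1} = ENNReal.ofReal p)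
    (h01 : ∀ᵐ ω ∂μ, B ω = 1 ∨ B ω = 0) (hBY : IndepFun B Y μ)
    {f f' : ℝ → ℝ} (hf : ∀ x, HasDerivAt f (f' x) x) {K : ℝ≥0} (hfL : LipschitzWith K f)
    (hf' : LipschitzWith 2 f') (α : ℝ) {W : Ω → ℝ}
    (hW : W = fun ω => Y ω + α * ((B ω - p) / √(p * (1 - p)))) :
    Integrable (fun ω => α * ((B ω - p) / √(p * (1 - p))) * f (W ω)) μ ∧
    |α ^ 2 * (∫ ω, f' (W ω) ∂μ) - ∫ ω, α * ((B ω - p) / √(p * (1 - p))) * f (W ω) ∂μ| ≤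
      2 * (|α| ^ 3 * (1 - 2 * p * (1 - p)) / √(p * (1 - p))) := by
  subst hW
  set s := √(p * (1 - p)) with hs
  have hpq : 0 < p * (1 - p) := mul_pos hp.1 (sub_pos.2 hp.2)
  have hs0 : 0 < s := Real.sqrt_pos.2 hpq
  have hss : p * (1 - p) = s * s := (Real.mul_self_sqrt hpq.le).symm
  obtain ⟨hi, h1⟩ := integral_bernoulli_mul hB hY hp.1.le hone h01 hBY hfL
    (fun z => α * ((z - p) / s)) (fun z => α * ((z - p) / s))
  obtain ⟨-, h2⟩ := integral_bernoulli_mul hB hY hp.1.le hone h01 hBY hf'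
    (fun _ => 1) (fun z => α * ((z - p) / s))
  simp only [one_mul] at h2
  refine ⟨hi, ?_⟩
  have hshift : ∀ {g : ℝ → ℝ} {L : ℝ≥0}, LipschitzWith L g → ∀ z,
      Integrable (fun ω => g (Y ω + z)) μ := fun hg z =>
    hg.integrable_comp_of_integrable (hY.add (integrable_const z))
  rw [h1, h2, ← integral_const_mul, ← integral_sub, ← Real.norm_eq_abs]
  · refine (norm_integral_le_of_norm_le_const (ae_of_all _ fun ω => ?_)).trans_eq
      (by rw [probReal_univ, mul_one])
    rw [Real.norm_eq_abs]
    convert abs_two_point_stein_le hf hf' hp α (Y ω) using 2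
    rw [← hs]
    have h3 : p * (1 - p) / s = s := by rw [hss]; field_simp
    linear_combination (-α * f (Y ω + α * ((1 - p) / s)) + α * f (Y ω + α * ((0 - p) / s))) * h3
  · exact (((hshift hf' _).const_mul _).add ((hshift hf' _).const_mul _)).const_mul _
  · exact (((hshift hfL _).const_mul _).const_mul _).add
      (((hshift hfL _).const_mul _).const_mul _)

end Bernoulli

theorem bernoulli_weighted_sum_wasserstein_bound
    {Ω : Type*} [MeasureSpace Ω] [IsProbabilityMeasure (ℙ : Measure Ω)]
    (n : ℕ) (p : Fin n → ℝ) (hp : ∀ k, p k ∈ Set.Ioo (0 : ℝ) 1)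
    (B : Fin n → Ω → ℝ) (α : Fin n → ℝ)
    (hmeas : ∀ k, Measurable (B k))
    (hindep : iIndepFun B ℙ)
    (hone : ∀ k, ℙ {ω | B k ω = 1} = ENNReal.ofReal (p k))
    (hzero : ∀ k, ℙ {ω | B k ω = 0} = ENNReal.ofReal (1 - p k)) :
    dW (Measure.map
        (fun ω => ∑ k, α k * ((B k ω - p k) / Real.sqrt (p k * (1 - p k)))) ℙ)
      stdGaussian ≤
      |1 - ∑ k, (α k) ^ 2| +
        2 * ∑ k, |α k| ^ 3 * (1 - 2 * p k * (1 - p k)) / Real.sqrt (p k * (1 - p k)) := by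
  have : Nonempty {f : ℝ → ℝ // LipschitzWith 1 f} := ⟨⟨id, LipschitzWith.id⟩⟩
  refine ciSup_le fun ⟨h, hh⟩ => ?_
  simp only [_root_.stdGaussian]
  obtain ⟨f, f', hf, hstein, hf'L, hf'1⟩ := exists_steinSolution hh
  have hfL : LipschitzWith 1 f :=
    lipschitzWith_of_nnnorm_deriv_le (fun x => (hf x).differentiableAt) fun x => by
      rw [(hf x).deriv, ← NNReal.coe_le_coe, coe_nnnorm]
      exact hf'1 x
  have h01 : ∀ k, ∀ᵐ ω ∂(ℙ : Measure Ω), B k ω = 1 ∨ B k ω = 0 := fun k =>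
    ae_eq_one_or_eq_zero (hmeas k) (hp k) (hone k) (hzero k)
  set Z : Fin n → Ω → ℝ := fun k ω => α k * ((B k ω - p k) / √(p k * (1 - p k))) with hZ
  set W : Ω → ℝ := fun ω => ∑ k, Z k ω with hWdef
  have hZi : ∀ k, Integrable (Z k) := fun k =>
    (((integrable_of_ae_zero_one (hmeas k) (h01 k)).sub
      (integrable_const (p k))).div_const _).const_mul _
  have hWi : Integrable W := integrable_finsetSum _ fun k _ => hZi k
  have hterm : ∀ k, Integrable (fun ω => Z k ω * f (W ω)) ∧
      |α k ^ 2 * (∫ ω, f' (W ω)) - ∫ ω, Z k ω * f (W ω)| ≤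
        2 * (|α k| ^ 3 * (1 - 2 * p k * (1 - p k)) / √(p k * (1 - p k))) := by
    intro k
    refine abs_bernoulli_stein_le (Y := fun ω => ∑ j ∈ Finset.univ.erase k, Z j ω) (hmeas k)
      (integrable_finsetSum _ fun j _ => hZi j) (hp k) (hone k) (h01 k) ?_ hf hfL hf'L (α k)
      (funext fun ω => (Finset.sum_erase_add _ _ (Finset.mem_univ k)).symm)
    let g : Fin n → ℝ → ℝ := fun j =>
      if j = k then id else fun z => α j * ((z - p j) / √(p j * (1 - p j)))
    have hg : ∀ j, Measurable (g j) := fun j => by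
      by_cases hj : j = k
      · simp only [g, hj, if_true]; exact measurable_id
      · simp only [g, hj, if_false]; fun_prop
    have hind := ((hindep.comp g hg).indepFun_finsetSum_of_notMem
      (fun j => (hg j).comp (hmeas j)) (Finset.notMem_erase k Finset.univ)).symm
    have hY : (∑ j ∈ Finset.univ.erase k, g j ∘ B j) =
        fun ω => ∑ j ∈ Finset.univ.erase k, Z j ω := by
      funext ω
      rw [Finset.sum_apply]
      refine Finset.sum_congr rfl fun j hj => ?_
      simp [g, hZ, Finset.ne_of_mem_erase hj]
    rw [hY] at hind
    simpa [g] using hind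
  have hf'i : Integrable (fun ω => f' (W ω)) := hf'L.integrable_comp_of_integrable hWi
  have hf'int : |∫ ω, f' (W ω)| ≤ 1 := by
    have := norm_integral_le_of_norm_le_const (μ := (ℙ : Measure Ω)) (f := fun ω => f' (W ω))
      (C := 1) (ae_of_all _ fun ω => hf'1 (W ω))
    simpa using this
  have hsum : Integrable (fun ω => ∑ k, Z k ω * f (W ω)) :=
    integrable_finsetSum _ fun k _ => (hterm k).1
  have hmain : (∫ x, h x ∂Measure.map W ℙ) - ∫ x, h x ∂gaussianReal 0 1 =
      (1 - ∑ k, α k ^ 2) * (∫ ω, f' (W ω)) +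
        ∑ k, (α k ^ 2 * (∫ ω, f' (W ω)) - ∫ ω, Z k ω * f (W ω)) := by
    rw [integral_map hWi.1.aemeasurable hh.continuous.aestronglyMeasurable]
    have hpt : (fun ω => f' (W ω) - ∑ k, Z k ω * f (W ω)) =
        fun ω => h (W ω) - ∫ s, h s ∂gaussianReal 0 1 := by
      funext ω
      rw [← hstein, ← Finset.sum_mul]
    have h1 := integral_sub hf'i hsum
    rw [hpt, integral_sub (hh.integrable_comp_of_integrable hWi) (integrable_const _),
      integral_finsetSum _ fun k _ => (hterm k).1] at h1
    simp only [integral_const, probReal_univ, one_smul] at h1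
    rw [h1, Finset.sum_sub_distrib, ← Finset.sum_mul]
    ring
  rw [hmain]
  refine (abs_add_le _ _).trans (add_le_add ?_ ?_)
  · rw [abs_mul]
    exact mul_le_of_le_one_right (abs_nonneg _) hf'int
  · rw [Finset.mul_sum]
    exact (Finset.abs_sum_le_sum_abs _ _).trans (Finset.sum_le_sum fun k _ => (hterm k).2)
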